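/- arXiv:2312.02457 — 2 statements merged into one kernel-verified Lean document; each statement's English description precedes it below -/
import Mathlib

section
/- Let i ≥ 1 be an integer. A smooth function f : ℝ^m → ℝ belongs to F_i if and only if for every weighted path γ : ℝ → ℝ^m one has f(γ(t)) = O(t^i) as t → 0. (Local coordinate model of Proposition A.1(1): the weighting filtration is characterized by decay along weighted paths.) -/
open Asymptotics Topology

/-- The commutative ring of smooth real-valued functions on `ℝ^m`. -/
def SmoothFns (m : ℕ) : Subring ((Fin m → ℝ) → ℝ) where
  carrier := {f | ContDiff ℝ (⊤ : ℕ∞) f}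
  mul_mem' {f g} hf hg := by
    simp only [Set.mem_setOf_eq] at *
    exact hf.mul hg
  one_mem' := by
    simp only [Set.mem_setOf_eq]
    exact contDiff_const
  add_mem' {f g} hf hg := by
    simp only [Set.mem_setOf_eq] at *
    exact hf.add hg
  zero_mem' := by
    simp only [Set.mem_setOf_eq]
    exact contDiff_const
  neg_mem' {f} hf := by
    simp only [Set.mem_setOf_eq] at *
    exact hf.neg

lemma mem_smoothFns {m : ℕ} {f : (Fin m → ℝ) → ℝ} : f ∈ SmoothFns m ↔ ContDiff ℝ (⊤ : ℕ∞) f :=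
  Iff.rfl

/-- The monomial `x ^ α` as a smooth function. -/
def monomial (m : ℕ) (α : Fin m → ℕ) : SmoothFns m :=
  ⟨fun x => ∏ a, x a ^ α a,
    mem_smoothFns.mpr <| contDiff_prod fun a _ => (contDiff_apply ℝ ℝ a).pow (α a)⟩

/-- The local model of a weighting: the ideal of smooth functions generated by the
monomials of weighted degree at least `i`. -/
def weightIdeal (m : ℕ) (w : Fin m → ℕ) (i : ℤ) : Ideal (SmoothFns m) :=
  Ideal.span {f | ∃ α : Fin m → ℕ, i ≤ ∑ a, (α a : ℤ) * (w a : ℤ) ∧ f = monomial m α}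

/-- A weighted path. -/
def IsWeightedPath (m : ℕ) (w : Fin m → ℕ) (γ : ℝ → Fin m → ℝ) : Prop :=
  ContDiff ℝ (⊤ : ℕ∞) γ ∧ ∀ a, (fun t => γ t a) =O[𝓝 (0:ℝ)] fun t => t ^ (w a)

/-- Smoothness of integrals depending on a parameter. -/
lemma contDiff_param_integral {H : Type} [NormedAddCommGroup H] [NormedSpace ℝ H] [ProperSpace H]
    (n : ℕ) : ∀ {F : Type} [NormedAddCommGroup F] [NormedSpace ℝ F]
      (G : H × ℝ → F), ContDiff ℝ n G →
      ContDiff ℝ n (fun x => ∫ t in (0:ℝ)..1, G (x, t)) := by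
  induction n with
  | zero =>
    intro F _ _ G hG
    have hc : Continuous G := hG.continuous
    exact contDiff_zero.2
      (intervalIntegral.continuous_parametric_intervalIntegral_of_continuous' (by simpa [Function.uncurry_def] using hc) 0 1)
  | succ n ih =>
    intro F _ _ G hG
    have hG1 : ContDiff ℝ (n + 1) G := by exact_mod_cast hG
    have hc : Continuous G := hG.continuous
    let G' : H × ℝ → (H →L[ℝ] F) := fun p =>
      (fderiv ℝ G p).comp (ContinuousLinearMap.inl ℝ H ℝ)
    have hG' : ContDiff ℝ n G' :=
      ContDiff.clm_comp (contDiff_succ_iff_fderiv.1 hG1).2.2 contDiff_const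
    have hc' : Continuous G' := hG'.continuous
    have key : ContDiff ℝ ((n : WithTop ℕ∞) + 1) (fun x => ∫ t in (0:ℝ)..1, G (x, t)) := by
      refine contDiff_succ_iff_hasFDerivAt.2 ⟨fun x => ∫ t in (0:ℝ)..1, G' (x, t), ih G' hG', ?_⟩
      intro x₀
      have hK : IsCompact (Metric.closedBall x₀ 1 ×ˢ Set.Icc (0:ℝ) 1) :=
        (isCompact_closedBall x₀ 1).prod isCompact_Icc
      obtain ⟨C, hC⟩ := hK.exists_bound_of_continuousOn hc'.continuousOn
      refine intervalIntegral.hasFDerivAt_integral_of_dominated_of_fderiv_le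
        (F := fun x t => G (x, t)) (F' := fun x t => G' (x, t)) (bound := fun _ => C)
        (s := Metric.closedBall x₀ 1) (Metric.closedBall_mem_nhds _ one_pos) ?_ ?_ ?_ ?_ ?_ ?_
      · refine Filter.Eventually.of_forall fun x => ?_
        exact (hc.comp (by fun_prop : Continuous fun t : ℝ => (x, t))).aestronglyMeasurable
      · exact (hc.comp (by fun_prop : Continuous fun t : ℝ => (x₀, t))).intervalIntegrable _ _
      · exact (hc'.comp (by fun_prop : Continuous fun t : ℝ => (x₀, t))).aestronglyMeasurable
      · refine Filter.Eventually.of_forall fun t ht x hx => hC _ ⟨hx, ?_⟩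
        rw [Set.uIoc_of_le zero_le_one] at ht
        exact ⟨ht.1.le, ht.2⟩
      · exact intervalIntegrable_const
      · refine Filter.Eventually.of_forall fun t _ x _ => ?_
        have h1 : HasFDerivAt G (fderiv ℝ G (x, t)) (x, t) :=
          ((hG1.differentiable (by simp)) (x, t)).hasFDerivAt
        exact h1.comp x (hasFDerivAt_prodMk_left x t)
    exact_mod_cast key

lemma contDiff_top_param_integral {H : Type} [NormedAddCommGroup H] [NormedSpace ℝ H]
    [ProperSpace H] {F : Type} [NormedAddCommGroup F] [NormedSpace ℝ F]
    (G : H × ℝ → F) (hG : ContDiff ℝ (⊤ : ℕ∞) G) :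
    ContDiff ℝ (⊤ : ℕ∞) (fun x => ∫ t in (0:ℝ)..1, G (x, t)) :=
  contDiff_infty.2 fun n => contDiff_param_integral n G (contDiff_infty.1 hG n)

/-- Hadamard's lemma along a set of coordinates: `P` projects to the coordinates outside. -/
lemma hadamard_split {m : ℕ} (w : Fin m → ℕ) (f : (Fin m → ℝ) → ℝ)
    (hf : ContDiff ℝ (⊤ : ℕ∞) f) :
    ∃ g : Fin m → (Fin m → ℝ) → ℝ, (∀ a, ContDiff ℝ (⊤ : ℕ∞) (g a)) ∧
      ∀ x, f x = f (fun a => if w a = 0 then x a else 0) +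
        ∑ a, (if w a = 0 then 0 else x a * g a x) := by
  -- the segment
  let L : (Fin m → ℝ) × ℝ → (Fin m → ℝ) := fun p a =>
    (if w a = 0 then p.1 a else 0) + p.2 * (if w a = 0 then 0 else p.1 a)
  have hL : ContDiff ℝ (⊤ : ℕ∞) L := by
    refine contDiff_pi.2 fun a => ?_
    have h1 : ContDiff ℝ (⊤ : ℕ∞) (fun p : (Fin m → ℝ) × ℝ => p.1 a) :=
      (contDiff_apply ℝ ℝ a).comp contDiff_fst
    by_cases h : w a = 0
    · simpa [L, h] using h1
    · simpa [L, h] using contDiff_snd.mul h1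
  have hdf : ContDiff ℝ (⊤ : ℕ∞) (fderiv ℝ f) := (contDiff_infty_iff_fderiv.1 hf).2
  have hG : ∀ a, ContDiff ℝ (⊤ : ℕ∞)
      (fun p : (Fin m → ℝ) × ℝ => fderiv ℝ f (L p) (Pi.single a 1)) := fun a =>
    (hdf.comp hL).clm_apply contDiff_const
  refine ⟨fun a x => ∫ t in (0:ℝ)..1, fderiv ℝ f (L (x, t)) (Pi.single a 1),
    fun a => contDiff_top_param_integral _ (hG a), fun x => ?_⟩
  let v : Fin m → ℝ := fun a => if w a = 0 then 0 else x a
  have hderiv : ∀ t : ℝ, HasDerivAt (fun t => f (L (x, t))) (fderiv ℝ f (L (x, t)) v) t := by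
    intro t
    have h1 : HasDerivAt (fun t => L (x, t)) v t := by
      refine hasDerivAt_pi.2 fun a => ?_
      have := ((hasDerivAt_id t).mul_const (v a)).const_add (if w a = 0 then x a else 0)
      simpa [L, v] using this
    exact ((hf.differentiable (by simp) (L (x, t))).hasFDerivAt).comp_hasDerivAt t h1
  have hcont : ∀ u : Fin m → ℝ, Continuous fun t : ℝ => fderiv ℝ f (L (x, t)) u := fun u =>
    (((hdf.comp hL).clm_apply contDiff_const).continuous).comp
      (by fun_prop : Continuous fun t : ℝ => (x, t))
  have hftc := intervalIntegral.integral_eq_sub_of_hasDerivAt (a := 0) (b := 1)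
    (fun t _ => hderiv t) ((hcont v).intervalIntegrable _ _)
  have hL1 : L (x, 1) = x := by
    ext a; by_cases h : w a = 0 <;> simp [L, h]
  have hL0 : L (x, 0) = fun a => if w a = 0 then x a else 0 := by
    ext a; simp [L]
  rw [hL1, hL0] at hftc
  have hsum : ∀ t : ℝ, fderiv ℝ f (L (x, t)) v =
      ∑ a, v a * fderiv ℝ f (L (x, t)) (Pi.single a 1) := by
    intro t
    conv_lhs => rw [pi_eq_sum_univ' v]
    simp [map_sum]
  simp_rw [hsum] at hftc
  rw [intervalIntegral.integral_finsetSum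
    (fun a _ => ((hcont _).const_mul (v a)).intervalIntegrable _ _)] at hftc
  simp_rw [intervalIntegral.integral_const_mul] at hftc
  have : ∀ a, v a * (∫ t in (0:ℝ)..1, fderiv ℝ f (L (x, t)) (Pi.single a 1)) =
      if w a = 0 then 0 else x a * ∫ t in (0:ℝ)..1, fderiv ℝ f (L (x, t)) (Pi.single a 1) := by
    intro a; by_cases h : w a = 0 <;> simp [v, h]
  simp_rw [this] at hftc
  linarith

/-- Smooth functions that are polynomial of degree `< n` along weighted dilations. -/
def QuasiPoly (m : ℕ) (w : Fin m → ℕ) (n : ℕ) (h : (Fin m → ℝ) → ℝ) : Prop :=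
  ∀ c : Fin m → ℝ, ∃ P : Polynomial ℝ, P.degree < n ∧
    ∀ t : ℝ, h (fun a => c a * t ^ w a) = P.eval t

lemma coord_mul_mem {m : ℕ} {w : Fin m → ℕ} {n : ℕ} (a : Fin m) {r : SmoothFns m}
    (hr : r ∈ weightIdeal m w ((n - w a : ℕ) : ℤ)) :
    monomial m (Pi.single a 1) * r ∈ weightIdeal m w n := by
  refine Submodule.span_induction (p := fun r _ =>
    monomial m (Pi.single a 1) * r ∈ weightIdeal m w n) ?_ ?_ ?_ ?_ hr
  · rintro _ ⟨α, hα, rfl⟩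
    refine Ideal.subset_span ⟨Pi.single a 1 + α, ?_, ?_⟩
    · have : ∑ b, (((Pi.single a 1 : Fin m → ℕ) b : ℕ) : ℤ) * (w b : ℤ) = w a := by
        rw [Finset.sum_eq_single a] <;> simp +contextual [Pi.single_apply]
      simp only [Pi.add_apply, Nat.cast_add, add_mul, Finset.sum_add_distrib, this]
      omega
    · ext x
      simp [monomial, pow_add, Finset.prod_mul_distrib]
  · simp
  · intro x y _ _ hx hy
    rw [mul_add]; exact Ideal.add_mem _ hx hy
  · intro s x _ hx
    rw [smul_eq_mul, mul_left_comm]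
    exact Ideal.mul_mem_left _ _ hx

lemma weightIdeal_zero {m : ℕ} {w : Fin m → ℕ} (f : SmoothFns m) : f ∈ weightIdeal m w 0 := by
  have h1 : (1 : SmoothFns m) ∈ weightIdeal m w 0 := by
    refine Ideal.subset_span ⟨0, by simp, ?_⟩
    ext x; simp [monomial]
  simpa using Ideal.mul_mem_left _ f h1

lemma exists_decomp {m : ℕ} (w : Fin m → ℕ) (n : ℕ) : ∀ f : SmoothFns m,
    ∃ h r : SmoothFns m, f = h + r ∧ r ∈ weightIdeal m w n ∧
      QuasiPoly m w n (h : (Fin m → ℝ) → ℝ) := by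
  induction n using Nat.strong_induction_on with
  | _ n ih =>
  intro f
  rcases Nat.eq_zero_or_pos n with rfl | hn
  · refine ⟨0, f, by simp, weightIdeal_zero f, fun c => ⟨0, by simp, by simp⟩⟩
  obtain ⟨g, hg, hfg⟩ := hadamard_split w f f.2
  have hstep : ∀ a, ∃ h r : SmoothFns m, r ∈ weightIdeal m w n ∧
      QuasiPoly m w n (h : (Fin m → ℝ) → ℝ) ∧
      ∀ x, (h : (Fin m → ℝ) → ℝ) x + (r : (Fin m → ℝ) → ℝ) x =
        if w a = 0 then 0 else x a * g a x := by
    intro a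
    by_cases ha : w a = 0
    · exact ⟨0, 0, by simp, fun c => ⟨0, by simp [WithBot.bot_lt_coe], by simp⟩, by simp [ha]⟩
    obtain ⟨h, r, hfhr, hr, hh⟩ := ih (n - w a) (by omega) ⟨g a, hg a⟩
    have hmon : ∀ x, (monomial m (Pi.single a 1) : (Fin m → ℝ) → ℝ) x = x a := by
      intro x
      simp only [monomial]
      rw [Finset.prod_eq_single a] <;> simp +contextual [Pi.single_apply]
    refine ⟨monomial m (Pi.single a 1) * h, monomial m (Pi.single a 1) * r,
      coord_mul_mem a hr, ?_, ?_⟩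
    · intro c
      obtain ⟨P, hP, hev⟩ := hh c
      refine ⟨Polynomial.C (c a) * (Polynomial.X ^ w a * P), ?_, ?_⟩
      · by_cases hP0 : P = 0
        · simp [hP0, WithBot.bot_lt_coe]
        · have h1 : P.natDegree < n - w a := (Polynomial.natDegree_lt_iff_degree_lt hP0).2 hP
          rw [← Polynomial.smul_eq_C_mul]
          refine lt_of_le_of_lt (Polynomial.degree_smul_le _ _) ?_
          rw [Polynomial.degree_mul, Polynomial.degree_X_pow, Polynomial.degree_eq_natDegree hP0]
          norm_cast
          omega
      · intro t
        simp only [Subring.coe_mul, Pi.mul_apply, hmon, hev]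
        simp; ring
    · intro x
      have := congrFun (congrArg Subtype.val hfhr) x
      simp only [Subring.coe_add, Pi.add_apply] at this
      simp [ha, hmon, this, mul_add]
  choose h r hr hh hsum using hstep
  have hproj : ContDiff ℝ (⊤ : ℕ∞)
      (fun x : Fin m → ℝ => (f : (Fin m → ℝ) → ℝ) (fun a => if w a = 0 then x a else 0)) := by
    refine ContDiff.comp (mem_smoothFns.1 f.2) (contDiff_pi.2 fun a => ?_)
    by_cases ha : w a = 0
    · simpa [ha] using contDiff_apply ℝ ℝ a
    · simpa [ha] using contDiff_const
  have hcoe : ∀ (k : Fin m → SmoothFns m) (x : Fin m → ℝ),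
      ((∑ a, k a : SmoothFns m) : (Fin m → ℝ) → ℝ) x = ∑ a, (k a : (Fin m → ℝ) → ℝ) x := by
    intro k x
    rw [AddSubmonoidClass.coe_finset_sum, Finset.sum_apply]
  refine ⟨⟨_, hproj⟩ + ∑ a, h a, ∑ a, r a, ?_, Ideal.sum_mem _ fun a _ => hr a, ?_⟩
  · ext x
    simp only [Subring.coe_add, Pi.add_apply, hcoe]
    rw [hfg x, add_assoc, ← Finset.sum_add_distrib]
    simp only [hsum]
  · intro c
    choose P hP hev using fun a => hh a c
    refine ⟨Polynomial.C ((f : (Fin m → ℝ) → ℝ) (fun a => if w a = 0 then c a else 0)) +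
      ∑ a, P a, ?_, ?_⟩
    · rw [← Polynomial.mem_degreeLT]
      refine add_mem ?_ (Submodule.sum_mem _ fun a _ => Polynomial.mem_degreeLT.2 (hP a))
      rw [Polynomial.mem_degreeLT]
      exact lt_of_le_of_lt Polynomial.degree_C_le (by exact_mod_cast hn)
    · intro t
      simp only [Subring.coe_add, Pi.add_apply, hcoe, hev, Polynomial.eval_add, Polynomial.eval_C,
        Polynomial.eval_finset_sum]
      congr 1
      refine congrArg _ (funext fun a => ?_)
      by_cases ha : w a = 0 <;> simp [ha]

/-- A polynomial of degree `< n` that is `O(t^n)` at zero vanishes. -/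
lemma poly_eq_zero_of_isBigO (n : ℕ) (P : Polynomial ℝ) (hP : P.degree < n)
    (hO : (fun t => P.eval t) =O[𝓝 (0:ℝ)] fun t => t ^ n) : P = 0 := by
  by_contra h0
  obtain ⟨Q, hQ, hndvd⟩ := Polynomial.exists_eq_pow_rootMultiplicity_mul_and_not_dvd P h0 0
  set k := P.rootMultiplicity 0
  have hk : k < n := by
    have h1 : k ≤ P.natDegree := by
      have := Polynomial.natDegree_le_of_dvd (Dvd.intro _ hQ.symm) h0
      simpa using this
    have := (Polynomial.natDegree_lt_iff_degree_lt h0).2 hP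
    omega
  have hQ0 : Q.eval 0 ≠ 0 := fun h => hndvd (Polynomial.dvd_iff_isRoot.2 h)
  simp only [map_zero, sub_zero] at hQ
  obtain ⟨C, hC⟩ := hO.bound
  have hev : ∀ᶠ t in 𝓝[≠] (0:ℝ), |Q.eval t| ≤ C * |t| ^ (n - k) := by
    filter_upwards [hC.filter_mono nhdsWithin_le_nhds, self_mem_nhdsWithin] with t ht ht0
    have htpos : 0 < |t| ^ k := pow_pos (abs_pos.2 ht0) _
    have h2 : |t| ^ n = |t| ^ k * |t| ^ (n - k) := by rw [← pow_add]; congr 1; omega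
    rw [hQ] at ht
    simp only [Polynomial.eval_mul, Polynomial.eval_pow, Polynomial.eval_X, Real.norm_eq_abs,
      abs_mul, abs_pow, h2] at ht
    refine le_of_mul_le_mul_left ?_ htpos
    linarith
  have l1 : Filter.Tendsto (fun t => |Q.eval t|) (𝓝[≠] (0:ℝ)) (𝓝 |Q.eval 0|) :=
    (Q.continuous.abs.tendsto 0).mono_left nhdsWithin_le_nhds
  have l2 : Filter.Tendsto (fun t : ℝ => C * |t| ^ (n - k)) (𝓝[≠] (0:ℝ)) (𝓝 0) := by
    have : Continuous fun t : ℝ => C * |t| ^ (n - k) := by fun_prop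
    have h3 := (this.tendsto 0).mono_left (nhdsWithin_le_nhds (s := {(0:ℝ)}ᶜ))
    have hne : n - k ≠ 0 := by omega
    simpa [hne] using h3
  have := le_of_tendsto_of_tendsto l1 l2 hev
  exact hQ0 (abs_eq_zero.1 (le_antisymm this (abs_nonneg _)))

lemma isBigO_of_mem {m : ℕ} {w : Fin m → ℕ} {n : ℕ} {f : SmoothFns m}
    (hf : f ∈ weightIdeal m w n) (γ : ℝ → Fin m → ℝ) (hγ : IsWeightedPath m w γ) :
    (fun t => (f : (Fin m → ℝ) → ℝ) (γ t)) =O[𝓝 (0:ℝ)] fun t => t ^ n := by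
  refine Submodule.span_induction (p := fun (f : SmoothFns m) _ =>
    (fun t => (f : (Fin m → ℝ) → ℝ) (γ t)) =O[𝓝 (0:ℝ)] fun t => t ^ n) ?_ ?_ ?_ ?_ hf
  · rintro _ ⟨α, hα, rfl⟩
    have h1 : (fun t => ∏ a, γ t a ^ α a) =O[𝓝 (0:ℝ)] fun t => ∏ a, (t ^ w a) ^ α a :=
      IsBigO.finsetProd fun a _ => (hγ.2 a).pow (α a)
    have h2 : ∀ t : ℝ, ∏ a, (t ^ w a) ^ α a = t ^ (∑ a, α a * w a) := by
      intro t
      rw [← Finset.prod_pow_eq_pow_sum]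
      refine Finset.prod_congr rfl fun a _ => ?_
      rw [← pow_mul, mul_comm]
    simp only [h2] at h1
    have hle : n ≤ ∑ a, α a * w a := by exact_mod_cast hα
    refine h1.trans ?_
    refine IsBigO.of_bound 1 ?_
    filter_upwards [Metric.closedBall_mem_nhds (0:ℝ) one_pos] with t ht
    have ht' : |t| ≤ 1 := by simpa using ht
    simp only [norm_pow, Real.norm_eq_abs, one_mul]
    exact pow_le_pow_of_le_one (abs_nonneg t) ht' hle
  · exact isBigO_zero _ _
  · intro x y _ _ hx hy
    exact hx.add hy
  · intro s x _ hx
    have hs : Continuous fun t => (s : (Fin m → ℝ) → ℝ) (γ t) :=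
      (mem_smoothFns.1 s.2).continuous.comp hγ.1.continuous
    have h1 : (fun t => (s : (Fin m → ℝ) → ℝ) (γ t)) =O[𝓝 (0:ℝ)] fun _ => (1:ℝ) :=
      (hs.tendsto 0).isBigO_one ℝ
    simpa using h1.mul hx

/-- For an integer `i ≥ 1`, a smooth function `f : ℝ^m → ℝ` belongs to the
weighting ideal `F_i` if and only if `f ∘ γ (t) = O(t^i)` as `t → 0` for every weighted
path `γ : ℝ → ℝ^m`. -/
theorem mem_weightIdeal_iff_isBigO_along_weightedPaths
    (m : ℕ) (w : Fin m → ℕ) (i : ℤ) (hi : 1 ≤ i) (f : SmoothFns m) :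
    f ∈ weightIdeal m w i ↔
      ∀ γ : ℝ → Fin m → ℝ, IsWeightedPath m w γ →
        (fun t => (f : (Fin m → ℝ) → ℝ) (γ t)) =O[𝓝 (0:ℝ)] fun t => t ^ i := by
  lift i to ℕ using by omega with n
  simp only [zpow_natCast]
  refine ⟨fun hf γ hγ => isBigO_of_mem hf γ hγ, fun H => ?_⟩
  obtain ⟨h, r, rfl, hr, hh⟩ := exists_decomp w n f
  suffices h = 0 by simpa [this] using hr
  ext c
  obtain ⟨P, hP, hev⟩ := hh c
  have hγ : IsWeightedPath m w (fun t a => c a * t ^ w a) := by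
    refine ⟨contDiff_pi.2 fun a => contDiff_const.mul (contDiff_id.pow _), fun a => ?_⟩
    exact isBigO_const_mul_self _ _ _
  have h1 := (H _ hγ).sub (isBigO_of_mem hr _ hγ)
  simp only [Subring.coe_add, Pi.add_apply, add_sub_cancel_right, hev] at h1
  have hP0 := poly_eq_zero_of_isBigO n P hP h1
  have := hev 1
  simpa [hP0] using this
end

section
/- Assume w_a ≥ 1 for every a, and let i ≥ 1 be an integer. Then every smooth function f : ℝ^m → ℝ admits a decomposition f = Σ_{⟨α,w⟩ < i} c_α x^α + g, where the sum runs over the finitely many multi-indices α ∈ ℕ^m with ⟨α, w⟩ < i, the c_α are real constants, and g ∈ F_i. (Weighted Taylor expansion with remainder in the weighting ideal, as used in the proof of Proposition A.1.) -/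
open Asymptotics Topology

lemma aux_contDiff_integral {E : Type} [NormedAddCommGroup E] [NormedSpace ℝ E]
    [FiniteDimensional ℝ E] (n : ℕ) :
    ∀ {G : Type} [NormedAddCommGroup G] [NormedSpace ℝ G] [CompleteSpace G]
      (F : E × ℝ → G), ContDiff ℝ (⊤ : ℕ∞) F →
      ContDiff ℝ n (fun x => ∫ t in (0:ℝ)..1, F (x, t)) := by
  have : ProperSpace E := FiniteDimensional.proper_real E
  induction n with
  | zero =>
    intro G _ _ _ F hF
    have hc := hF.continuous
    rw [Nat.cast_zero, contDiff_zero]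
    exact intervalIntegral.continuous_parametric_intervalIntegral_of_continuous'
      (f := fun x t => F (x, t)) hc 0 1
  | succ n ih =>
    intro G _ _ _ F hF
    have hF' : ContDiff ℝ (⊤ : ℕ∞)
        (fun p : E × ℝ => (fderiv ℝ F p).comp (ContinuousLinearMap.inl ℝ E ℝ)) :=
      (hF.fderiv_right (m := (⊤ : ℕ∞)) (by simp)).clm_comp contDiff_const
    have hc := hF.continuous
    have hc' := hF'.continuous
    rw [Nat.cast_succ, contDiff_succ_iff_hasFDerivAt]
    refine ⟨_, ih _ hF', fun x => ?_⟩
    obtain ⟨C, hC⟩ := ((isCompact_closedBall x 1).prod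
      (isCompact_Icc (a := (0:ℝ)) (b := 1))).exists_bound_of_continuousOn hc'.continuousOn
    refine intervalIntegral.hasFDerivAt_integral_of_dominated_of_fderiv_le
      (F := fun x t => F (x, t))
      (F' := fun x t => (fderiv ℝ F (x, t)).comp (ContinuousLinearMap.inl ℝ E ℝ))
      (bound := fun _ => C)
      (Metric.closedBall_mem_nhds x one_pos) ?_ ?_ ?_ ?_ ?_ ?_
    · exact Filter.Eventually.of_forall fun y =>
        (hc.comp (by fun_prop : Continuous fun t : ℝ => (y, t))).aestronglyMeasurable
    · exact (hc.comp (by fun_prop : Continuous fun t : ℝ => (x, t))).intervalIntegrable _ _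
    · exact (hc'.comp (by fun_prop : Continuous fun t : ℝ => (x, t))).aestronglyMeasurable
    · refine Filter.Eventually.of_forall fun t ht y hy => hC (y, t) ⟨hy, ?_⟩
      rw [Set.uIoc_of_le zero_le_one] at ht
      exact ⟨ht.1.le, ht.2⟩
    · exact intervalIntegrable_const
    · refine Filter.Eventually.of_forall fun t ht y hy => ?_
      have h1 : HasFDerivAt F (fderiv ℝ F (y, t)) (y, t) :=
        (hF.differentiable (by simp) (y, t)).hasFDerivAt
      exact h1.comp y (hasFDerivAt_prodMk_left y t)

lemma aux_hadamard {m : ℕ} (f : SmoothFns m) :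
    ∃ g : Fin m → SmoothFns m, ∀ x : Fin m → ℝ,
      (f : (Fin m → ℝ) → ℝ) x =
        (f : (Fin m → ℝ) → ℝ) 0 + ∑ a, x a * (g a : (Fin m → ℝ) → ℝ) x := by
  have hf : ContDiff ℝ (⊤ : ℕ∞) (f : (Fin m → ℝ) → ℝ) := f.2
  set φ : (Fin m → ℝ) → ℝ := (f : (Fin m → ℝ) → ℝ) with hφ
  have hd : ∀ a : Fin m, ContDiff ℝ (⊤ : ℕ∞)
      (fun p : (Fin m → ℝ) × ℝ => fderiv ℝ φ (p.2 • p.1) (Pi.single a 1)) := fun a =>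
    ((hf.fderiv_right (m := (⊤ : ℕ∞)) (by simp)).comp
      (contDiff_snd.smul contDiff_fst)).clm_apply contDiff_const
  refine ⟨fun a => ⟨fun x => ∫ t in (0:ℝ)..1, fderiv ℝ φ (t • x) (Pi.single a 1),
    mem_smoothFns.mpr (contDiff_infty.mpr fun n => aux_contDiff_integral n _ (hd a))⟩,
    fun x => ?_⟩
  have hci : ∀ a : Fin m, Continuous (fun t : ℝ => fderiv ℝ φ (t • x) (Pi.single a 1)) :=
    fun a => (hd a).continuous.comp (by fun_prop : Continuous fun t : ℝ => (x, t))
  have hder : ∀ t : ℝ, HasDerivAt (fun t : ℝ => φ (t • x))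
      (∑ a, x a * fderiv ℝ φ (t • x) (Pi.single a 1)) t := by
    intro t
    have h1 : HasFDerivAt φ (fderiv ℝ φ (t • x)) (t • x) :=
      (hf.differentiable (by simp) _).hasFDerivAt
    have h2 : HasDerivAt (fun t : ℝ => t • x) x t := by
      simpa using (hasDerivAt_id t).smul_const x
    have h3 := h1.comp_hasDerivAt t h2
    convert! h3 using 1
    conv_rhs => rw [pi_eq_sum_univ' x]
    rw [map_sum]
    refine Finset.sum_congr rfl fun a _ => ?_
    rw [map_smul, smul_eq_mul]
    rw [← pi_eq_sum_univ' x]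
  have key := intervalIntegral.integral_eq_sub_of_hasDerivAt (a := 0) (b := 1)
    (fun t _ => hder t)
    ((continuous_finsetSum _ fun a _ => (hci a).const_mul (x a)).intervalIntegrable _ _)
  rw [intervalIntegral.integral_finsetSum
    (fun a _ => ((hci a).const_mul (x a)).intervalIntegrable _ _)] at key
  simp only [intervalIntegral.integral_const_mul, one_smul, zero_smul] at key
  change φ x = φ 0 + ∑ a, x a * ∫ t in (0:ℝ)..1, fderiv ℝ φ (t • x) (Pi.single a 1)
  rw [key]
  ring

/-- A smooth function admits a weighted Taylor decomposition. -/
def AuxDecomp (m : ℕ) (w : Fin m → ℕ) (i : ℤ) (f : (Fin m → ℝ) → ℝ) : Prop :=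
  ∃ c : (Fin m → ℕ) → ℝ, ∃ g ∈ weightIdeal m w i,
      ∀ x : Fin m → ℝ,
        f x =
          (∑ α ∈ (Fintype.piFinset fun _ : Fin m => Finset.range i.toNat).filter
              (fun α => (∑ a, (α a : ℤ) * (w a : ℤ)) < i),
            c α * ∏ a, x a ^ α a) + (g : (Fin m → ℝ) → ℝ) x

lemma AuxDecomp.add {m : ℕ} {w : Fin m → ℕ} {i : ℤ} {f g : (Fin m → ℝ) → ℝ}
    (hf : AuxDecomp m w i f) (hg : AuxDecomp m w i g) :
    AuxDecomp m w i (fun x => f x + g x) := by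
  obtain ⟨c, u, hu, h⟩ := hf
  obtain ⟨d, v, hv, k⟩ := hg
  refine ⟨fun α => c α + d α, u + v, Ideal.add_mem _ hu hv, fun x => ?_⟩
  simp only [h, k, add_mul, Finset.sum_add_distrib, Subring.coe_add, Pi.add_apply]
  ring

lemma AuxDecomp.of_mem {m : ℕ} {w : Fin m → ℕ} {i : ℤ} (g : SmoothFns m)
    (hg : g ∈ weightIdeal m w i) : AuxDecomp m w i g :=
  ⟨0, g, hg, fun x => by simp⟩

lemma AuxDecomp.sum {m : ℕ} {w : Fin m → ℕ} {i : ℤ} {ι : Type} (s : Finset ι)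
    (f : ι → (Fin m → ℝ) → ℝ) (h : ∀ a ∈ s, AuxDecomp m w i (f a)) :
    AuxDecomp m w i (fun x => ∑ a ∈ s, f a x) := by
  classical
  induction s using Finset.induction_on with
  | empty => exact AuxDecomp.of_mem (0 : SmoothFns m) (Ideal.zero_mem _)
  | insert a s ha ih =>
    simp only [Finset.sum_insert ha]
    exact (h a (by simp)).add (ih fun b hb => h b (by simp [hb]))

lemma AuxDecomp.monomial {m : ℕ} {w : Fin m → ℕ} (hw : ∀ a, 1 ≤ w a) {i : ℤ}
    (c : ℝ) (α : Fin m → ℕ) (h : ∑ a, (α a : ℤ) * (w a : ℤ) < i) :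
    AuxDecomp m w i (fun x => c * ∏ a, x a ^ α a) := by
  classical
  refine ⟨fun β => if β = α then c else 0, 0, Ideal.zero_mem _, fun x => ?_⟩
  have hmem : α ∈ (Fintype.piFinset fun _ : Fin m => Finset.range i.toNat).filter
              (fun α => (∑ a, (α a : ℤ) * (w a : ℤ)) < i) := by
    simp only [Finset.mem_filter, Fintype.mem_piFinset, Finset.mem_range]
    refine ⟨fun a => ?_, h⟩
    have h1 : (α a : ℤ) * (w a : ℤ) ≤ ∑ a, (α a : ℤ) * (w a : ℤ) :=
      Finset.single_le_sum (f := fun a => (α a : ℤ) * (w a : ℤ))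
        (fun b _ => by positivity) (Finset.mem_univ a)
    have h2 : (1 : ℤ) ≤ w a := by exact_mod_cast hw a
    have h3 : (α a : ℤ) ≤ (α a : ℤ) * (w a : ℤ) := le_mul_of_one_le_right (by positivity) h2
    omega
  simp only [ite_mul, zero_mul, Finset.sum_ite_eq', if_pos hmem]
  simp

lemma aux_main {m : ℕ} {w : Fin m → ℕ} (hw : ∀ a, 1 ≤ w a) {i : ℤ} (n : ℕ) :
    ∀ (α : Fin m → ℕ) (f : SmoothFns m), i ≤ ∑ a, (α a : ℤ) * (w a : ℤ) + n →
      AuxDecomp m w i (fun x => (f : (Fin m → ℝ) → ℝ) x * ∏ a, x a ^ α a) := by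
  classical
  induction n with
  | zero =>
    intro α f h
    exact AuxDecomp.of_mem (f * _root_.monomial m α)
      (Ideal.mul_mem_left _ _ (Ideal.subset_span ⟨α, by simpa using h, rfl⟩))
  | succ n ih =>
    intro α f h
    by_cases hα : ∑ a, (α a : ℤ) * (w a : ℤ) < i
    · obtain ⟨g, hg⟩ := aux_hadamard f
      have key : ∀ b ∈ Finset.univ, AuxDecomp m w i (fun x => (g b : (Fin m → ℝ) → ℝ) x *
          ∏ a, x a ^ (α + Pi.single b 1 : Fin m → ℕ) a) := by
        intro b _
        refine ih _ (g b) ?_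
        have : ∑ a, (((α + Pi.single b 1 : Fin m → ℕ) a : ℕ) : ℤ) * (w a : ℤ)
            = ∑ a, (α a : ℤ) * (w a : ℤ) + w b := by
          simp [Pi.single_apply, add_mul, Finset.sum_add_distrib]
        rw [this]
        have := hw b
        push_cast at h
        omega
      convert! (AuxDecomp.monomial hw ((f : (Fin m → ℝ) → ℝ) 0) α hα).add
        (AuxDecomp.sum _ _ key) using 2 with x
      rw [hg x, add_mul, Finset.sum_mul]
      congr 1
      refine Finset.sum_congr rfl fun b _ => ?_
      have : ∏ a, x a ^ (α + Pi.single b 1 : Fin m → ℕ) a = (∏ a, x a ^ α a) * x b := by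
        simp only [Pi.add_apply, pow_add, Finset.prod_mul_distrib]
        congr 1
        rw [Finset.prod_eq_single b] <;> simp +contextual
      rw [this]
      ring
    · exact AuxDecomp.of_mem (f * _root_.monomial m α)
        (Ideal.mul_mem_left _ _ (Ideal.subset_span ⟨α, by simpa using hα, rfl⟩))

/-- (Weighted Taylor expansion.) If every weight satisfies `w_a ≥ 1` and
`i ≥ 1` is an integer, then every smooth function `f : ℝ^m → ℝ` decomposes as a finite linear
combination of the monomials `x^α` with weighted degree `⟨α, w⟩ < i`, plus a remainder lying in
the weighting ideal `F_i`. -/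
theorem weighted_taylor_expansion
    (m : ℕ) (w : Fin m → ℕ) (hw : ∀ a, 1 ≤ w a) (i : ℤ) (hi : 1 ≤ i)
    (f : SmoothFns m) :
    ∃ c : (Fin m → ℕ) → ℝ, ∃ g ∈ weightIdeal m w i,
      ∀ x : Fin m → ℝ,
        (f : (Fin m → ℝ) → ℝ) x =
          (∑ α ∈ (Fintype.piFinset fun _ : Fin m => Finset.range i.toNat).filter
              (fun α => (∑ a, (α a : ℤ) * (w a : ℤ)) < i),
            c α * ∏ a, x a ^ α a) + (g : (Fin m → ℝ) → ℝ) x := by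
  have h := aux_main hw (i := i) i.toNat 0 f (by simp)
  simpa [AuxDecomp] using h
end
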